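/- arXiv:2109.01865 — 2 statements merged into one kernel-verified Lean document; each statement's English description precedes it below -/
import Mathlib

section
/- Under the setting of the normalized ZH-type nonmonotone LMM (Algorithm 2) with η_max < 1, assume (i) p is continuous on V_0, (ii) t_k ≥ δ for some δ > 0 and all k, (iii) inf_{k≥0} E(w_k) > −∞, and that E satisfies the (PS) condition. Then {w_k} contains a subsequence converging to a critical point u_* ∉ L; moreover, if u_* is an isolated critical point, then the whole sequence w_k → u_* as k → ∞. -/
open Filter Topology Set
open scoped RealInnerProductSpace ENNReal

noncomputable section

/-- The half subspace `[L, v] = {t • v + w : t ≥ 0, w ∈ L}`. -/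
def halfspaceCone {X : Type*} [NormedAddCommGroup X] [InnerProductSpace ℝ X]
    (L : Submodule ℝ X) (v : X) : Set X :=
  {y | ∃ t : ℝ, 0 ≤ t ∧ ∃ w ∈ (L : Set X), y = t • v + w}

/-- The normalized gradient-step map `v(α) = (v - α g)/‖v - α g‖`. -/
def stepv {X : Type*} [NormedAddCommGroup X] [InnerProductSpace ℝ X] (v g : X) (α : ℝ) : X :=
  ‖v - α • g‖⁻¹ • (v - α • g)

/-- The set `V₀ = {v = v⊥ + τ v₀^L ∈ S : v⊥ ∈ L⊥, 0 ≤ τ ≤ 1}`. -/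
def V0 {X : Type*} [NormedAddCommGroup X] [InnerProductSpace ℝ X]
    (L : Submodule ℝ X) (v0L : X) : Set X :=
  {v | ‖v‖ = 1 ∧ ∃ w ∈ (Lᗮ : Set X), ∃ τ : ℝ, 0 ≤ τ ∧ τ ≤ 1 ∧ v = w + τ • v0L}

section Normed

variable {X : Type*} [NormedAddCommGroup X] [InnerProductSpace ℝ X]

lemma one_le_norm_sub_smul {v g : X} (hv : ‖v‖ = 1) (hvg : ⟪v, g⟫ = 0) (α : ℝ) :
    1 ≤ ‖v - α • g‖ := by
  have h := norm_sub_sq_real v (α • g)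
  rw [inner_smul_right, hvg, hv] at h
  nlinarith [sq_nonneg ‖α • g‖, norm_nonneg (v - α • g)]

lemma norm_stepv {v g : X} (hv : ‖v‖ = 1) (hvg : ⟪v, g⟫ = 0) (α : ℝ) :
    ‖stepv v g α‖ = 1 := by
  have h := one_le_norm_sub_smul hv hvg α
  rw [stepv, norm_smul, norm_inv, norm_norm, inv_mul_cancel₀ (by positivity)]

lemma stepv_zero {v : X} (hv : ‖v‖ = 1) (g : X) : stepv v g 0 = v := by
  simp [stepv, hv]

lemma norm_stepv_sub_le {v g : X} (hv : ‖v‖ = 1) (hvg : ⟪v, g⟫ = 0) {α : ℝ} (hα : 0 ≤ α) :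
    ‖stepv v g α - v‖ ≤ 2 * (α * ‖g‖) := by
  have h1 := one_le_norm_sub_smul hv hvg α
  set x := v - α • g with hx
  have hxv : ‖x - v‖ = α * ‖g‖ := by
    rw [hx, sub_sub_cancel_left, norm_neg, norm_smul, Real.norm_of_nonneg hα]
  have hle : ‖x‖ ≤ 1 + α * ‖g‖ := by
    have := norm_add_le v (x - v)
    rwa [add_sub_cancel, hxv, hv] at this
  have hnorm : ‖‖x‖⁻¹ • x - x‖ = ‖x‖ - 1 := by
    have : ‖x‖⁻¹ • x - x = (‖x‖⁻¹ - 1) • x := by rw [sub_smul, one_smul]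
    have h2 : ‖x‖⁻¹ ≤ 1 := inv_le_one_of_one_le₀ h1
    rw [this, norm_smul, Real.norm_of_nonpos (by linarith)]
    have h3 : ‖x‖⁻¹ * ‖x‖ = 1 := inv_mul_cancel₀ (by positivity)
    linarith
  calc ‖stepv v g α - v‖ = ‖(‖x‖⁻¹ • x - x) + (x - v)‖ := by rw [stepv, ← hx]; abel_nf
    _ ≤ ‖‖x‖⁻¹ • x - x‖ + ‖x - v‖ := norm_add_le _ _
    _ ≤ 2 * (α * ‖g‖) := by rw [hnorm, hxv]; linarith

lemma continuous_stepv {v g : X} (hv : ‖v‖ = 1) (hvg : ⟪v, g⟫ = 0) :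
    Continuous (stepv v g) := by
  have h : ∀ α : ℝ, ‖v - α • g‖ ≠ 0 := fun α => by
    linarith [one_le_norm_sub_smul hv hvg α] |> fun (h : 0 < ‖v - α • g‖) => h.ne'
  exact ((by fun_prop : Continuous fun α : ℝ => ‖v - α • g‖).inv₀ h).smul (by fun_prop)

lemma stepv_mem_V0 {L : Submodule ℝ X} {v0L v g : X} (hv : v ∈ V0 L v0L) (hg : g ∈ Lᗮ)
    (hvg : ⟪v, g⟫ = 0) (α : ℝ) : stepv v g α ∈ V0 L v0L := by
  obtain ⟨hv1, w, hw, τ, hτ0, hτ1, hvw⟩ := hv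
  have h1 := one_le_norm_sub_smul hv1 hvg α
  refine ⟨norm_stepv hv1 hvg α, ‖v - α • g‖⁻¹ • (w - α • g),
    Lᗮ.smul_mem _ (Lᗮ.sub_mem hw (Lᗮ.smul_mem _ hg)), ‖v - α • g‖⁻¹ * τ, by positivity,
    mul_le_one₀ (inv_le_one_of_one_le₀ h1) hτ0 hτ1, ?_⟩
  rw [stepv, mul_smul, ← smul_add]
  congr 1
  conv_lhs => rw [hvw]
  abel

variable {L : Submodule ℝ X} [L.HasOrthogonalProjection]

lemma mem_V0_iff {v0L : X} (hv0L : v0L ∈ L) {v : X} :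
    v ∈ V0 L v0L ↔
      ‖v‖ = 1 ∧ L.starProjection v ∈ (fun τ : ℝ => τ • v0L) '' Icc (0 : ℝ) 1 := by
  refine and_congr_right fun _ => ⟨?_, ?_⟩
  · rintro ⟨w, hw, τ, h0, h1, rfl⟩
    refine ⟨τ, ⟨h0, h1⟩, ?_⟩
    rw [map_add, L.starProjection_apply_eq_zero_iff.2 hw, zero_add,
      Submodule.starProjection_eq_self_iff.2 (L.smul_mem τ hv0L)]
  · rintro ⟨τ, ⟨h0, h1⟩, h⟩
    refine ⟨v - L.starProjection v, L.sub_starProjection_mem_orthogonal v, τ, h0, h1, ?_⟩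
    simp only at h
    rw [h, sub_add_cancel]

lemma isClosed_V0 {v0L : X} (hv0L : v0L ∈ L) : IsClosed (V0 L v0L) := by
  have : V0 L v0L = {v | ‖v‖ = 1} ∩
      L.starProjection ⁻¹' ((fun τ : ℝ => τ • v0L) '' Icc (0 : ℝ) 1) := by
    ext v
    exact mem_V0_iff hv0L
  rw [this]
  exact (isClosed_eq continuous_norm continuous_const).inter
    ((isCompact_Icc.image (by fun_prop)).isClosed.preimage L.starProjection.continuous)

lemma norm_le_norm_starProjection_orthogonal_of_mem_V0 {v0perp v0L : X}
    (hv0perp : v0perp ∈ Lᗮ) (hv0L : v0L ∈ L) (hv0norm : ‖v0perp + v0L‖ = 1)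
    {v : X} (hv : v ∈ V0 L v0L) : ‖v0perp‖ ≤ ‖Lᗮ.starProjection v‖ := by
  obtain ⟨hv1, w, hw, τ, h0, h1, rfl⟩ := hv
  have hP : Lᗮ.starProjection (w + τ • v0L) = w := by
    rw [map_add, Submodule.starProjection_eq_self_iff.2 hw,
      Lᗮ.starProjection_apply_eq_zero_iff.2 (L.le_orthogonal_orthogonal (L.smul_mem τ hv0L)),
      add_zero]
  have e1 := norm_add_sq_real v0perp v0L
  have e2 := norm_add_sq_real w (τ • v0L)
  rw [real_inner_comm, hv0perp _ hv0L, hv0norm] at e1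
  rw [real_inner_comm, hw _ (L.smul_mem τ hv0L), hv1, norm_smul, Real.norm_of_nonneg h0] at e2
  rw [hP]
  have h3 : (τ * ‖v0L‖) ^ 2 ≤ ‖v0L‖ ^ 2 :=
    pow_le_pow_left₀ (by positivity) (mul_le_of_le_one_left (norm_nonneg _) h1) 2
  exact le_of_sq_le_sq (by linarith) (norm_nonneg _)

end Normed

section Derivative

variable {X : Type*} [NormedAddCommGroup X] [InnerProductSpace ℝ X] {E : X → ℝ}

lemma fderiv_eq_zero_of_isLocalMaxOn {s : Set X} {y d : X} (hE : DifferentiableAt ℝ E y)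
    (hmax : IsLocalMaxOn E s y) (hd : ∀ᶠ r : ℝ in 𝓝 0, y + r • d ∈ s) :
    fderiv ℝ E y d = 0 := by
  have hline : HasDerivAt (fun r : ℝ => y + r • d) d 0 := by
    simpa using ((hasDerivAt_id (0 : ℝ)).smul_const d).const_add y
  have hderiv : HasDerivAt (fun r : ℝ => E (y + r • d)) (fderiv ℝ E y d) 0 := by
    have h : HasFDerivAt E (fderiv ℝ E y) (y + (0 : ℝ) • d) := by
      simpa using hE.hasFDerivAt
    exact h.comp_hasDerivAt 0 hline
  refine IsLocalMax.hasDerivAt_eq_zero ?_ hderiv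
  have ht : Tendsto (fun r : ℝ => y + r • d) (𝓝 0) (𝓝[s] y) := by
    refine tendsto_nhdsWithin_iff.2 ⟨?_, hd⟩
    simpa using hline.continuousAt.tendsto
  simpa [IsLocalMax, IsMaxFilter] using ht.eventually hmax

variable {L : Submodule ℝ X} {v y w : X} {t : ℝ}

lemma fderiv_apply_self_eq_zero_of_isLocalMaxOn_halfspaceCone (hE : DifferentiableAt ℝ E y)
    (hmax : IsLocalMaxOn E (halfspaceCone L v) y) (ht : 0 < t) (hw : w ∈ L)
    (hy : y = t • v + w) : fderiv ℝ E y v = 0 := by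
  refine fderiv_eq_zero_of_isLocalMaxOn hE hmax ?_
  filter_upwards [lt_mem_nhds (neg_lt_zero.2 ht)] with r hr
  exact ⟨t + r, by linarith, w, hw, by rw [hy, add_smul]; abel⟩

lemma fderiv_apply_eq_zero_of_isLocalMaxOn_halfspaceCone (hE : DifferentiableAt ℝ E y)
    (hmax : IsLocalMaxOn E (halfspaceCone L v) y) (ht : 0 ≤ t) (hw : w ∈ L)
    (hy : y = t • v + w) {z : X} (hz : z ∈ L) : fderiv ℝ E y z = 0 := by
  refine fderiv_eq_zero_of_isLocalMaxOn hE hmax (Eventually.of_forall fun r => ?_)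
  exact ⟨t, ht, w + r • z, L.add_mem hw (L.smul_mem _ hz), by rw [hy, add_assoc]⟩

/-- If the energy at `a x` locally dominates its values at `a z + (z - x) κ(z) g`, then the
slope of `E ∘ a` to the right of `x` is asymptotically at most `-κ(x) E'(a x) g`. -/
lemma eventually_slope_lt_of_shift_le (hE : ContDiff ℝ 1 E) {a : ℝ → X} {κ : ℝ → ℝ} {g : X}
    {x : ℝ} (ha : Tendsto a (𝓝[>] x) (𝓝 (a x))) (hκ : Tendsto κ (𝓝[>] x) (𝓝 (κ x)))
    (hle : ∀ᶠ z in 𝓝[>] x, E (a z + ((z - x) * κ z) • g) ≤ E (a x)) {r : ℝ}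
    (hr : -(κ x * fderiv ℝ E (a x) g) < r) :
    ∀ᶠ z in 𝓝[>] x, slope (fun z => E (a z)) x z < r := by
  set D := fderiv ℝ E (a x)
  have hsub : Tendsto (fun z : ℝ => z - x) (𝓝[>] x) (𝓝 0) := by
    have : Tendsto (fun z : ℝ => z - x) (𝓝 x) (𝓝 (x - x)) :=
      (continuous_id.sub continuous_const).tendsto x
    rw [sub_self] at this
    exact this.mono_left nhdsWithin_le_nhds
  have hy : Tendsto (fun z => a z + ((z - x) * κ z) • g) (𝓝[>] x) (𝓝 (a x)) := by
    simpa using ha.add ((hsub.mul hκ).smul_const g)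
  have hstrict := (hE.contDiffAt (x := a x)).hasStrictFDerivAt one_ne_zero
  have ho := hstrict.isLittleO.comp_tendsto (ha.prodMk_nhds hy)
  have hO : (fun z => a z - (a z + ((z - x) * κ z) • g)) =O[𝓝[>] x] fun z => z - x := by
    have h1 : (fun z => κ z • g) =O[𝓝[>] x] fun _ => (1 : ℝ) := (hκ.smul_const g).isBigO_one ℝ
    have h2 := (Asymptotics.isBigO_refl (fun z : ℝ => z - x) (𝓝[>] x)).smul h1
    refine (h2.neg_left).congr (fun z => ?_) fun z => by simp
    rw [smul_smul]; abel
  have hlim := (ho.trans_isBigO hO).tendsto_div_nhds_zero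
  have hlim2 : Tendsto (fun z => (E (a z) - E (a z + ((z - x) * κ z) • g)) / (z - x))
      (𝓝[>] x) (𝓝 (-(κ x * D g))) := by
    have h := hlim.add ((hκ.mul_const (D g)).neg)
    rw [zero_add] at h
    refine h.congr' ?_
    filter_upwards [self_mem_nhdsWithin] with z hz
    have hz' : z - x ≠ 0 := sub_ne_zero.2 (ne_of_gt hz)
    simp only [Function.comp_apply, sub_add_cancel_left, map_neg, map_smul, smul_eq_mul]
    field_simp
    ring
  filter_upwards [hlim2.eventually_lt_const hr, hle, self_mem_nhdsWithin] with z h1 h2 hz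
  refine lt_of_le_of_lt ?_ h1
  rw [slope_def_field]
  exact div_le_div_of_nonneg_right (by linarith) (sub_nonneg.2 (le_of_lt hz))

/-- Descent of the energy along the normalized gradient curve `α ↦ p (v(α))`, only using that
each `p u` is a local maximizer on its own half subspace. -/
lemma energy_stepv_le (hE : ContDiff ℝ 1 E) {p : X → X} {t : X → ℝ} {wL : X → X}
    (hmax : ∀ u : X, ‖u‖ = 1 → IsLocalMaxOn E (halfspaceCone L u) (p u))
    (hdecomp : ∀ u : X, ‖u‖ = 1 → p u = t u • u + wL u ∧ 0 ≤ t u ∧ wL u ∈ L)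
    {g : X} (hv : ‖v‖ = 1) (hvg : ⟪v, g⟫ = 0) {β c : ℝ} (hβ : 0 ≤ β)
    (hp : ContinuousOn (fun α => p (stepv v g α)) (Icc 0 β))
    (htc : ContinuousOn (fun α => t (stepv v g α)) (Icc 0 β))
    (hc : ∀ α ∈ Icc 0 β,
      c < t (stepv v g α) * ‖v - α • g‖⁻¹ * fderiv ℝ E (p (stepv v g α)) g) :
    E (p (stepv v g β)) ≤ E (p v) - c * β := by
  set κ : ℝ → ℝ := fun α => t (stepv v g α) * ‖v - α • g‖⁻¹ with hκ
  have hN : ∀ α : ℝ, 0 < ‖v - α • g‖ := fun α =>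
    zero_lt_one.trans_le (one_le_norm_sub_smul hv hvg α)
  have hκc : ContinuousOn κ (Icc 0 β) :=
    htc.mul ((by fun_prop : Continuous fun α : ℝ => ‖v - α • g‖).inv₀
      fun α => (hN α).ne').continuousOn
  have hB : ∀ x : ℝ, HasDerivAt (fun α => E (p v) - c * α) (-c) x := fun x => by
    simpa using ((hasDerivAt_id x).const_mul c).const_sub (E (p v))
  refine image_le_of_liminf_slope_right_lt_deriv_boundary
    (f := fun α => E (p (stepv v g α)))
    (f' := fun α => -(κ α * fderiv ℝ E (p (stepv v g α)) g))
    (hE.continuous.comp_continuousOn hp) ?_ (by simp [stepv_zero hv]) hB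
    (fun x hx _ => neg_lt_neg (hc x (Ico_subset_Icc_self hx))) ⟨hβ, le_rfl⟩
  intro x hx r hr
  have hx' := Ico_subset_Icc_self hx
  have hle : 𝓝[>] x ≤ 𝓝[Icc 0 β] x :=
    nhdsWithin_le_of_mem (mem_of_superset (Ioc_mem_nhdsGT hx.2)
      fun z hz => ⟨hx.1.trans hz.1.le, hz.2⟩)
  have ha : Tendsto (fun α => p (stepv v g α)) (𝓝[>] x) (𝓝 (p (stepv v g x))) :=
    (hp x hx').tendsto.mono_left hle
  have hκx : Tendsto κ (𝓝[>] x) (𝓝 (κ x)) := (hκc x hx').tendsto.mono_left hle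
  have hsub : Tendsto (fun z : ℝ => z - x) (𝓝[>] x) (𝓝 0) := by
    have : Tendsto (fun z : ℝ => z - x) (𝓝 x) (𝓝 (x - x)) :=
      (continuous_id.sub continuous_const).tendsto x
    rw [sub_self] at this
    exact this.mono_left nhdsWithin_le_nhds
  have hy : Tendsto (fun z => p (stepv v g z) + ((z - x) * κ z) • g) (𝓝[>] x)
      (𝓝[halfspaceCone L (stepv v g x)] (p (stepv v g x))) := by
    refine tendsto_nhdsWithin_iff.2
      ⟨by simpa using ha.add ((hsub.mul hκx).smul_const g), Eventually.of_forall fun z => ?_⟩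
    obtain ⟨h1, h2, h3⟩ := hdecomp _ (norm_stepv hv hvg z)
    refine ⟨κ z * ‖v - x • g‖, by have := hN z; positivity, _, h3, ?_⟩
    have e1 : t (stepv v g z) • stepv v g z = κ z • (v - z • g) := by
      rw [stepv, smul_smul]; rfl
    have e2 : (κ z * ‖v - x • g‖) • stepv v g x = κ z • (v - x • g) := by
      rw [stepv, smul_smul, mul_assoc, mul_inv_cancel₀ (hN x).ne', mul_one]
    rw [h1, e1, e2]
    module
  exact (eventually_slope_lt_of_shift_le hE ha hκx
    (hy.eventually (hmax _ (norm_stepv hv hvg x))) hr).frequently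

end Derivative

section Sequences

/-- Zhang–Hager nonmonotone line search: the reference values dominate the energies, decrease,
and the guaranteed decreases are summable. -/
lemma summable_of_nonmonotone_decrease {e a C Q η : ℕ → ℝ} {η₁ : ℝ} (hη₁ : η₁ < 1)
    (hη0 : ∀ k, 0 ≤ η k) (hη : ∀ k, η k ≤ η₁) (hQ0 : Q 0 = 1) (hC0 : C 0 = e 0)
    (hQ : ∀ k, Q (k + 1) = η k * Q k + 1)
    (hC : ∀ k, C (k + 1) = (η k * Q k * C k + e (k + 1)) / Q (k + 1))
    (ha : ∀ k, 0 ≤ a k) (he : ∀ k, e (k + 1) ≤ C k - a k) (hbdd : BddBelow (range e)) :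
    (∀ k, e k ≤ C k) ∧ Antitone C ∧ Summable a := by
  have hη₁0 : 0 ≤ η₁ := (hη0 0).trans (hη 0)
  have hQ1 : ∀ k, 1 ≤ Q k ∧ Q k * (1 - η₁) ≤ 1 := by
    intro k
    induction k with
    | zero => rw [hQ0]; constructor <;> linarith
    | succ k ih =>
      have h1 : 0 ≤ η k * Q k := mul_nonneg (hη0 k) (by linarith)
      have h2 : η k * (Q k * (1 - η₁)) ≤ η₁ * 1 :=
        mul_le_mul (hη k) ih.2 (mul_nonneg (by linarith) (by linarith)) hη₁0
      rw [hQ]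
      constructor <;> linarith
  have hCQ : ∀ k, C (k + 1) * Q (k + 1) = η k * Q k * C k + e (k + 1) := fun k => by
    rw [hC, div_mul_cancel₀]
    linarith [(hQ1 (k + 1)).1]
  have hdec : ∀ k, (1 - η₁) * a k ≤ C k - C (k + 1) := by
    intro k
    have h1 : a k ≤ (C k - C (k + 1)) * Q (k + 1) := by
      have := hCQ k
      have := he k
      have := hQ k
      have h : C k * Q (k + 1) = C k * (η k * Q k + 1) := by rw [hQ]
      linarith
    have hpos : 0 ≤ C k - C (k + 1) := by
      by_contra hneg
      push Not at hneg
      have := mul_neg_of_neg_of_pos hneg (by linarith [(hQ1 (k + 1)).1] : 0 < Q (k + 1))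
      linarith [ha k]
    calc (1 - η₁) * a k ≤ (1 - η₁) * ((C k - C (k + 1)) * Q (k + 1)) :=
          mul_le_mul_of_nonneg_left h1 (by linarith)
      _ = (C k - C (k + 1)) * (Q (k + 1) * (1 - η₁)) := by ring
      _ ≤ (C k - C (k + 1)) * 1 := mul_le_mul_of_nonneg_left (hQ1 (k + 1)).2 hpos
      _ = _ := mul_one _
  have heC : ∀ k, e k ≤ C k := by
    rintro (_ | k)
    · exact hC0.ge
    · have h1 := hCQ k
      have h2 : 0 ≤ η k * Q k * (C k - e (k + 1)) :=
        mul_nonneg (mul_nonneg (hη0 k) (by linarith [(hQ1 k).1])) (by linarith [he k, ha k])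
      have h3 : e (k + 1) * Q (k + 1) ≤ C (k + 1) * Q (k + 1) := by
        rw [h1, hQ]; linarith
      exact le_of_mul_le_mul_right h3 (by linarith [(hQ1 (k + 1)).1])
  refine ⟨heC, antitone_nat_of_succ_le fun k => ?_, ?_⟩
  · have := mul_nonneg (by linarith : 0 ≤ 1 - η₁) (ha k)
    linarith [hdec k]
  · obtain ⟨b, hb⟩ := hbdd
    have hs : Summable fun k => (1 - η₁) * a k := by
      refine summable_of_sum_range_le (c := C 0 - b)
        (fun k => mul_nonneg (by linarith) (ha k)) fun n => ?_
      calc ∑ i ∈ Finset.range n, (1 - η₁) * a i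
          ≤ ∑ i ∈ Finset.range n, (C i - C (i + 1)) := Finset.sum_le_sum fun i _ => hdec i
        _ = C 0 - C n := Finset.sum_range_sub' C n
        _ ≤ C 0 - b := by linarith [heC n, hb ⟨n, rfl⟩]
    exact (summable_mul_left_iff (by linarith)).1 hs

/-- A nonnegative sequence that is frequently small, has increments tending to zero, and has
summable increments while it stays in any thin annulus, tends to zero. -/
lemma tendsto_zero_of_annulus_summable {d s a : ℕ → ℝ} (hd : ∀ k, 0 ≤ d k)
    (ha : ∀ k, 0 ≤ a k) (hsum : Summable a) (hs : Tendsto s atTop (𝓝 0))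
    (hstep : ∀ k, d (k + 1) ≤ d k + s k) {r₀ : ℝ} (hr₀ : 0 < r₀)
    (hann : ∀ r, 0 < r → r < r₀ → ∃ M : ℝ, ∀ᶠ k in atTop, r / 2 ≤ d k → d k ≤ r → s k ≤ M * a k)
    (hfreq : ∀ r, 0 < r → ∃ᶠ k in atTop, d k < r) : Tendsto d atTop (𝓝 0) := by
  have key : ∀ r, 0 < r → r < r₀ → ∀ᶠ k in atTop, d k < r := by
    intro r hr hrr
    obtain ⟨M', hM'⟩ := hann r hr hrr
    set M := max M' 1
    have hM1 : 0 < M := zero_lt_one.trans_le (le_max_right _ _)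
    have hM : ∀ᶠ k in atTop, r / 2 ≤ d k → d k ≤ r → s k ≤ M * a k := by
      filter_upwards [hM'] with k hk h1 h2
      exact (hk h1 h2).trans (mul_le_mul_of_nonneg_right (le_max_left _ _) (ha k))
    have htail : ∀ᶠ k in atTop, ∑' j, a j - ∑ j ∈ Finset.range k, a j < r / 4 / M := by
      have : Tendsto (fun k => ∑' j, a j - ∑ j ∈ Finset.range k, a j) atTop (𝓝 0) := by
        simpa using hsum.hasSum.tendsto_sum_nat.const_sub (∑' j, a j)
      exact this.eventually_lt_const (by positivity)
    obtain ⟨K₀, hK₀⟩ := eventually_atTop.1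
      (hM.and (hs.eventually_lt_const (by positivity : 0 < r / 4)))
    obtain ⟨K, ⟨hdK, htK⟩, hKK⟩ :=
      (((hfreq (r / 2) (by positivity)).and_eventually htail).and_eventually
        (eventually_ge_atTop K₀)).exists
    set S : ℕ → ℝ := fun k => ∑ j ∈ Finset.range k, a j
    have hSmono : Monotone S := monotone_nat_of_le_succ fun k => by
      simp only [S, Finset.sum_range_succ]; linarith [ha k]
    have hbound : ∀ k, K ≤ k → M * (S k - S K) < r / 4 := by
      intro k _
      have : S k ≤ ∑' j, a j := hsum.sum_le_tsum _ fun j _ => ha j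
      rw [mul_comm, ← lt_div_iff₀ hM1]
      linarith
    have hind : ∀ k, K ≤ k → d k ≤ 3 / 4 * r + M * (S k - S K) := by
      intro k hk
      induction k, hk using Nat.le_induction with
      | base => linarith
      | succ k hk ih =>
        have hmono : S K ≤ S (k + 1) := hSmono (by omega)
        obtain ⟨h1, h2⟩ := hK₀ k (hKK.trans hk)
        rcases lt_or_ge (d k) (r / 2) with h | h
        · have := mul_nonneg hM1.le (sub_nonneg.2 hmono)
          linarith [hstep k]
        · have h3 := h1 h (by linarith [hbound k hk])
          have h4 : S (k + 1) = S k + a k := Finset.sum_range_succ _ _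
          rw [h4]
          linarith [hstep k]
    filter_upwards [eventually_ge_atTop K] with k hk
    linarith [hind k hk, hbound k hk]
  rw [Metric.tendsto_nhds]
  intro ε hε
  filter_upwards [key (min ε (r₀ / 2)) (by positivity)
    ((min_le_right _ _).trans_lt (by linarith))] with k hk
  rw [Real.dist_0_eq_abs, abs_of_nonneg (hd k)]
  exact hk.trans_le (min_le_left _ _)

/-- If each term is obtained from the previous one by a normalization factor in `[0, 1]`, the
sequence converges. -/
lemma exists_tendsto_of_smul_succ {X : Type*} [NormedAddCommGroup X] [NormedSpace ℝ X]
    {q : ℕ → X} {b : ℕ → ℝ} (hb0 : ∀ k, 0 ≤ b k) (hb1 : ∀ k, b k ≤ 1)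
    (hq : ∀ k, q (k + 1) = b k • q k) : ∃ x, Tendsto q atTop (𝓝 x) := by
  set c : ℕ → ℝ := fun k => ∏ j ∈ Finset.range k, b j
  have hc0 : ∀ k, 0 ≤ c k := fun k => Finset.prod_nonneg fun j _ => hb0 j
  have hc : Antitone c := antitone_nat_of_succ_le fun k => by
    simp only [c, Finset.prod_range_succ]
    exact mul_le_of_le_one_right (hc0 k) (hb1 k)
  have hqc : ∀ k, c k • q 0 = q k := by
    intro k
    induction k with
    | zero => simp [c]
    | succ k ih => rw [hq, ← ih, smul_smul]; simp only [c, Finset.prod_range_succ, mul_comm]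
  have hlim := tendsto_atTop_ciInf hc ⟨0, by rintro _ ⟨k, rfl⟩; exact hc0 k⟩
  exact ⟨_, (hlim.smul_const (q 0)).congr hqc⟩

end Sequences

/-- Theorem 3.6 (f): for the normalized ZH-type nonmonotone LMM with
`η_max < 1`, if additionally `E` satisfies the (PS) condition, then `{w_k}` contains a
subsequence converging to a critical point `u_* ∉ L`, and if `u_*` is isolated then the
whole sequence `w_k → u_*`. -/
theorem statement15
    {X : Type*} [NormedAddCommGroup X] [InnerProductSpace ℝ X] [CompleteSpace X]
    (E : X → ℝ) (hE : ContDiff ℝ 1 E)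
    (hPS : ∀ w : ℕ → X, (∃ b : ℝ, ∀ j, |E (w j)| ≤ b) →
      Tendsto (fun j => ‖fderiv ℝ E (w j)‖) atTop (nhds 0) →
      ∃ (u : X) (φ : ℕ → ℕ), StrictMono φ ∧ Tendsto (w ∘ φ) atTop (nhds u))
    (L : Submodule ℝ X) [FiniteDimensional ℝ L]
    (v0perp v0L : X) (hv0perp : v0perp ∈ Lᗮ) (hv0perp0 : v0perp ≠ 0) (hv0L : v0L ∈ L)
    (hv0norm : ‖v0perp + v0L‖ = 1)
    (p : X → X)
    (hpsel : ∀ u : X, ‖u‖ = 1 →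
      p u ∈ halfspaceCone L u ∧ IsLocalMaxOn E (halfspaceCone L u) (p u))
    (t : X → ℝ) (wL : X → X)
    (hdecomp : ∀ u : X, ‖u‖ = 1 → p u = t u • u + wL u ∧ 0 ≤ t u ∧ wL u ∈ L)
    (σ ρ : ℝ) (hσ : σ ∈ Set.Ioo (0 : ℝ) 1) (hρ : ρ ∈ Set.Ioo (0 : ℝ) 1)
    (lmin lmax : ℝ) (hlmin : 0 < lmin) (hlle : lmin ≤ lmax)
    (ηmin ηmax : ℝ) (hηmin : 0 ≤ ηmin) (hηlt : ηmin < ηmax) (hηmax : ηmax ≤ 1)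
    (hηmax1 : ηmax < 1)
    (lam η : ℕ → ℝ) (m : ℕ → ℕ) (α : ℕ → ℝ)
    (hlam : ∀ k, lam k ∈ Set.Icc lmin lmax)
    (hη : ∀ k, η k ∈ Set.Icc ηmin ηmax)
    (v : ℕ → X) (Q C : ℕ → ℝ)
    (hv00 : v 0 = v0perp + v0L)
    (hQ0 : Q 0 = 1) (hC0 : C 0 = E (p (v 0)))
    (hαdef : ∀ k, α k = lam k * ρ ^ m k)
    (hZH : ∀ k : ℕ,
      E (p (stepv (v k) (gradient E (p (v k))) (α k))) ≤
        C k - σ * α k * t (v k) * ‖gradient E (p (v k))‖ ^ 2)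
    (hmmin : ∀ k : ℕ, ∀ m' < m k,
      ¬ (E (p (stepv (v k) (gradient E (p (v k))) (lam k * ρ ^ m'))) ≤
        C k - σ * (lam k * ρ ^ m') * t (v k) * ‖gradient E (p (v k))‖ ^ 2))
    (hrecv : ∀ k, v (k + 1) = stepv (v k) (gradient E (p (v k))) (α k))
    (hrecQ : ∀ k, Q (k + 1) = η k * Q k + 1)
    (hrecC : ∀ k, C (k + 1) = (η k * Q k * C k + E (p (v (k + 1)))) / Q (k + 1))
    (hV0 : ∀ k, v k ∈ V0 L v0L)
    (hpc : ContinuousOn p (V0 L v0L))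
    (δ : ℝ) (hδ : 0 < δ) (ht : ∀ k, δ ≤ t (v k))
    (hbdd : BddBelow (Set.range fun k => E (p (v k)))) :
    ∃ (ustar : X) (φ : ℕ → ℕ), StrictMono φ ∧
      Tendsto (fun i => p (v (φ i))) atTop (nhds ustar) ∧
      ustar ∉ L ∧ fderiv ℝ E ustar = 0 ∧
      ((∀ᶠ u in nhds ustar, fderiv ℝ E u = 0 → u = ustar) →
        Tendsto (fun k => p (v k)) atTop (nhds ustar)) := by
  set g : ℕ → X := fun k => gradient E (p (v k)) with hg
  have hv1 : ∀ k, ‖v k‖ = 1 := fun k => (hV0 k).1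
  have hdiff : ∀ x, DifferentiableAt ℝ E x := fun x => hE.differentiable one_ne_zero x
  have hmax := fun u hu => (hpsel u hu).2
  have hnormg : ∀ x, ‖gradient E x‖ = ‖fderiv ℝ E x‖ := fun x =>
    (InnerProductSpace.toDual ℝ X).symm.norm_map _
  have hgrad : Continuous (gradient E) :=
    (InnerProductSpace.toDual ℝ X).symm.continuous.comp (hE.continuous_fderiv one_ne_zero)
  have hgL : ∀ k, g k ∈ Lᗮ := fun k z hz => by
    obtain ⟨h1, h2, h3⟩ := hdecomp _ (hv1 k)
    rw [real_inner_comm, inner_gradient_left]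
    exact fderiv_apply_eq_zero_of_isLocalMaxOn_halfspaceCone (hdiff _) (hmax _ (hv1 k)) h2 h3
      h1 hz
  have hvg : ∀ k, ⟪v k, g k⟫ = 0 := fun k => by
    obtain ⟨h1, h2, h3⟩ := hdecomp _ (hv1 k)
    rw [real_inner_comm, inner_gradient_left]
    exact fderiv_apply_self_eq_zero_of_isLocalMaxOn_halfspaceCone (hdiff _) (hmax _ (hv1 k))
      (hδ.trans_le (ht k)) h3 h1
  have hα0 : ∀ k, 0 < α k := fun k => by
    rw [hαdef]
    exact mul_pos (hlmin.trans_le (hlam k).1) (pow_pos hρ.1 _)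
  have hαmax : ∀ k, α k ≤ lmax := fun k => by
    rw [hαdef]
    exact (mul_le_of_le_one_right (hlmin.le.trans (hlam k).1)
      (pow_le_one₀ hρ.1.le hρ.2.le)).trans (hlam k).2
  have ht0 : ∀ k, 0 < t (v k) := fun k => hδ.trans_le (ht k)
  obtain ⟨heC, hCanti, hsum'⟩ := summable_of_nonmonotone_decrease
    (e := fun k => E (p (v k))) (a := fun k => σ * α k * t (v k) * ‖g k‖ ^ 2) hηmax1
    (fun k => hηmin.trans (hη k).1) (fun k => (hη k).2) hQ0 hC0 hrecQ hrecC
    (fun k => by have := hα0 k; have := ht0 k; have := hσ.1; positivity)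
    (fun k => by rw [hrecv]; exact hZH k) hbdd
  have hsum : Summable fun k => α k * ‖g k‖ ^ 2 := by
    refine Summable.of_nonneg_of_le (fun k => by have := hα0 k; positivity) (fun k => ?_)
      (hsum'.mul_left (σ * δ)⁻¹)
    have hσ0 := hσ.1
    rw [inv_mul_eq_div, le_div_iff₀ (by positivity)]
    have h : 0 ≤ σ * α k * ‖g k‖ ^ 2 := by have := hα0 k; positivity
    nlinarith [mul_le_mul_of_nonneg_left (ht k) h]
  have hstep : ∀ k, ‖v (k + 1) - v k‖ ≤ 2 * (α k * ‖g k‖) := fun k => by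
    rw [hrecv]
    exact norm_stepv_sub_le (hv1 k) (hvg k) (hα0 k).le
  have hP0 : 0 < ‖v0perp‖ := norm_pos_iff.2 hv0perp0
  have hPle : ∀ u ∈ V0 L v0L, ‖v0perp‖ ≤ ‖Lᗮ.starProjection u‖ := fun u hu =>
    norm_le_norm_starProjection_orthogonal_of_mem_V0 hv0perp hv0L hv0norm hu
  have hPp : ∀ u, ‖u‖ = 1 → Lᗮ.starProjection (p u) = t u • Lᗮ.starProjection u := by
    intro u hu
    obtain ⟨h1, -, h3⟩ := hdecomp u hu
    conv_lhs => rw [h1]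
    rw [map_add, map_smul,
      Lᗮ.starProjection_apply_eq_zero_iff.2 (L.le_orthogonal_orthogonal h3), add_zero]
  have htcont : ContinuousOn t (V0 L v0L) := by
    have h : ContinuousOn (fun u => ‖Lᗮ.starProjection (p u)‖ / ‖Lᗮ.starProjection u‖)
        (V0 L v0L) :=
      (Lᗮ.starProjection.continuous.comp_continuousOn hpc).norm.div
        Lᗮ.starProjection.continuous.norm.continuousOn
        fun u hu => (hP0.trans_le (hPle u hu)).ne'
    refine h.congr fun u hu => ?_
    have := hP0.trans_le (hPle u hu)
    simp only [hPp u hu.1, norm_smul, Real.norm_of_nonneg (hdecomp u hu.1).2.1,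
      mul_div_cancel_right₀ _ this.ne']
  have hfreq : ∀ ε > 0, ∃ᶠ k in atTop, ‖g k‖ < ε := by
    intro ε hε hcon
    simp only [not_lt] at hcon
    have hα : Tendsto α atTop (𝓝 0) := by
      have h := hsum.tendsto_atTop_zero.div_const (ε ^ 2)
      rw [zero_div] at h
      refine squeeze_zero' (Eventually.of_forall fun k => (hα0 k).le) ?_ h
      filter_upwards [hcon] with k hk
      rw [le_div_iff₀ (by positivity)]
      exact mul_le_mul_of_nonneg_left (pow_le_pow_left₀ hε.le hk 2) (hα0 k).le
    have hcauchy : CauchySeq v := by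
      refine cauchySeq_of_summable_dist
        (Summable.of_norm_bounded_eventually_nat (hsum.mul_left (2 / ε)) ?_)
      filter_upwards [hcon] with k hk
      rw [Real.norm_of_nonneg dist_nonneg, dist_comm, dist_eq_norm]
      refine (hstep k).trans ?_
      rw [div_mul_eq_mul_div, le_div_iff₀ hε]
      have : 0 ≤ 2 * (α k * ‖g k‖) := by have := hα0 k; positivity
      nlinarith [mul_le_mul_of_nonneg_left hk this]
    obtain ⟨vs, hvs⟩ := cauchySeq_tendsto_of_complete hcauchy
    have hvsV : vs ∈ V0 L v0L := (isClosed_V0 hv0L).mem_of_tendsto hvs (Eventually.of_forall hV0)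
    have hvsW : Tendsto v atTop (𝓝[V0 L v0L] vs) :=
      tendsto_nhdsWithin_iff.2 ⟨hvs, Eventually.of_forall hV0⟩
    have hp_lim : Tendsto (fun k => p (v k)) atTop (𝓝 (p vs)) := (hpc vs hvsV).tendsto.comp hvsW
    have ht_lim : Tendsto (fun k => t (v k)) atTop (𝓝 (t vs)) :=
      (htcont vs hvsV).tendsto.comp hvsW
    have hg_lim : Tendsto g atTop (𝓝 (gradient E (p vs))) := (hgrad.tendsto _).comp hp_lim
    have hgs : ε ≤ ‖gradient E (p vs)‖ := ge_of_tendsto hg_lim.norm hcon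
    have hts : δ ≤ t vs := ge_of_tendsto ht_lim (Eventually.of_forall ht)
    have hfst : Tendsto (fun x : ℕ × ℝ => x.1) (atTop ×ˢ 𝓝 0) atTop := tendsto_fst
    have hsnd : Tendsto (fun x : ℕ × ℝ => x.2) (atTop ×ˢ 𝓝 0) (𝓝 (0 : ℝ)) := tendsto_snd
    have hN : Tendsto (fun x : ℕ × ℝ => ‖v x.1 - x.2 • g x.1‖⁻¹) (atTop ×ˢ 𝓝 0) (𝓝 1) := by
      have h := ((hvs.comp hfst).sub (hsnd.smul (hg_lim.comp hfst))).norm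
      rw [zero_smul, sub_zero, hvsV.1] at h
      simpa using h.inv₀ one_ne_zero
    have hγ : Tendsto (fun x : ℕ × ℝ => stepv (v x.1) (g x.1) x.2) (atTop ×ˢ 𝓝 0)
        (𝓝[V0 L v0L] vs) := by
      refine tendsto_nhdsWithin_iff.2
        ⟨?_, Eventually.of_forall fun x => stepv_mem_V0 (hV0 _) (hgL _) (hvg _) _⟩
      simpa [stepv] using hN.smul ((hvs.comp hfst).sub (hsnd.smul (hg_lim.comp hfst)))
    have hΦ : Tendsto (fun x : ℕ × ℝ => t (stepv (v x.1) (g x.1) x.2) *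
        ‖v x.1 - x.2 • g x.1‖⁻¹ * ⟪gradient E (p (stepv (v x.1) (g x.1) x.2)), g x.1⟫ -
        σ * t (v x.1) * ‖g x.1‖ ^ 2) (atTop ×ˢ 𝓝 0)
        (𝓝 (t vs * 1 * ⟪gradient E (p vs), gradient E (p vs)⟫ -
          σ * t vs * ‖gradient E (p vs)‖ ^ 2)) :=
      ((((htcont vs hvsV).tendsto.comp hγ).mul hN).mul
        (((hgrad.tendsto _).comp ((hpc vs hvsV).tendsto.comp hγ)).inner
          (hg_lim.comp hfst))).sub
        (((ht_lim.comp hfst).const_mul σ).mul ((hg_lim.comp hfst).norm.pow 2))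
    have hpos : 0 < t vs * 1 * ⟪gradient E (p vs), gradient E (p vs)⟫ -
        σ * t vs * ‖gradient E (p vs)‖ ^ 2 := by
      have h1 : 0 < t vs := hδ.trans_le hts
      have h2 : 0 < ‖gradient E (p vs)‖ := hε.trans_le hgs
      have h3 : 0 < (1 - σ) * (t vs * ‖gradient E (p vs)‖ ^ 2) :=
        mul_pos (sub_pos.2 hσ.2) (by positivity)
      rw [real_inner_self_eq_norm_sq]
      linarith
    obtain ⟨pa, hpa, pb, hpb, hpab⟩ := eventually_prod_iff.1 (hΦ.eventually_const_lt hpos)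
    obtain ⟨r, hr, hrb⟩ := Metric.eventually_nhds_iff.1 hpb
    obtain ⟨k, hka, hkr, hkl⟩ := (hpa.and ((hα.eventually_lt_const
      (mul_pos hr hρ.1)).and (hα.eventually_lt_const hlmin))).exists
    have hm : m k ≠ 0 := by
      intro h0
      have := hαdef k
      rw [h0, pow_zero, mul_one] at this
      linarith [(hlam k).1]
    obtain ⟨n, hn⟩ := Nat.exists_eq_succ_of_ne_zero hm
    set β := lam k * ρ ^ n with hβ
    have hβ0 : 0 ≤ β := mul_nonneg (hlmin.le.trans (hlam k).1) (pow_nonneg hρ.1.le _)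
    have hβα : β * ρ = α k := by rw [hαdef, hn, pow_succ, hβ]; ring
    have hβr : β < r := lt_of_mul_lt_mul_right (hβα ▸ hkr) hρ.1.le
    have hγV : MapsTo (stepv (v k) (g k)) (Icc 0 β) (V0 L v0L) := fun z _ =>
      stepv_mem_V0 (hV0 k) (hgL k) (hvg k) z
    have hγc := (continuous_stepv (hv1 k) (hvg k)).continuousOn (s := Icc 0 β)
    refine hmmin k n (by omega) ?_
    have hdesc := energy_stepv_le (c := σ * t (v k) * ‖g k‖ ^ 2) hE hmax hdecomp (hv1 k)
      (hvg k) hβ0 (hpc.comp hγc hγV) (htcont.comp hγc hγV) fun z hz => by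
        have := hpab hka (hrb (y := z) (by
          rw [Real.dist_0_eq_abs, abs_of_nonneg hz.1]; exact hz.2.trans_lt hβr))
        simp only [inner_gradient_left] at this
        linarith
    calc E (p (stepv (v k) (g k) β)) ≤ E (p (v k)) - σ * t (v k) * ‖g k‖ ^ 2 * β := hdesc
      _ ≤ C k - σ * β * t (v k) * ‖g k‖ ^ 2 := by linarith [heC k]
  have hcluster : ∀ φ : ℕ → ℕ, Tendsto (fun i => ‖g (φ i)‖) atTop (𝓝 0) →
      ∃ (u : X) (ψ : ℕ → ℕ), StrictMono ψ ∧ Tendsto (fun i => p (v (φ (ψ i)))) atTop (𝓝 u) ∧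
        fderiv ℝ E u = 0 := by
    intro φ hφ
    obtain ⟨b, hb⟩ := hbdd
    obtain ⟨u, ψ, hψ, hu⟩ := hPS (fun i => p (v (φ i)))
      ⟨max (-b) (C 0), fun i => abs_le'.2 ⟨((heC _).trans (hCanti (Nat.zero_le _))).trans
        (le_max_right _ _), (neg_le_neg (hb ⟨φ i, rfl⟩)).trans (le_max_left _ _)⟩⟩
      (by simpa only [hg, hnormg] using hφ)
    refine ⟨u, ψ, hψ, hu, norm_eq_zero.1 ?_⟩
    rw [← hnormg]
    exact tendsto_nhds_unique ((hgrad.tendsto u).comp hu).norm (hφ.comp hψ.tendsto_atTop)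
  have hsmall : ∀ φ : ℕ → ℕ, (∀ n, ‖g (φ n)‖ < 1 / ((n : ℝ) + 1)) →
      Tendsto (fun i => ‖g (φ i)‖) atTop (𝓝 0) := fun φ hφ =>
    squeeze_zero (fun _ => norm_nonneg _) (fun n => (hφ n).le)
      tendsto_one_div_add_atTop_nhds_zero_nat
  obtain ⟨φ₀, hφ₀, hgφ₀⟩ := extraction_forall_of_frequently
    (P := fun n k => ‖g k‖ < 1 / ((n : ℝ) + 1)) fun n => hfreq _ (by positivity)
  obtain ⟨us, ψ₀, hψ₀, hus, hcrit⟩ := hcluster φ₀ (hsmall φ₀ hgφ₀)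
  have hPus : 0 < ‖Lᗮ.starProjection us‖ := by
    refine (mul_pos hδ hP0).trans_le (ge_of_tendsto
      ((Lᗮ.starProjection.continuous.tendsto us).comp hus).norm (Eventually.of_forall fun i => ?_))
    rw [Function.comp_apply, hPp _ (hv1 _), norm_smul, Real.norm_of_nonneg (ht0 _).le]
    exact mul_le_mul (ht _) (hPle _ (hV0 _)) hP0.le (ht0 _).le
  refine ⟨us, φ₀ ∘ ψ₀, hφ₀.comp hψ₀, hus, fun hL => ?_, hcrit, fun hiso => ?_⟩
  · rw [Lᗮ.starProjection_apply_eq_zero_iff.2 (L.le_orthogonal_orthogonal hL), norm_zero] at hPus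
    exact hPus.false
  obtain ⟨q, hq⟩ := exists_tendsto_of_smul_succ (q := fun k => L.starProjection (v k))
    (b := fun k => ‖v k - α k • g k‖⁻¹) (fun k => by positivity)
    (fun k => inv_le_one_of_one_le₀ (one_le_norm_sub_smul (hv1 k) (hvg k) _)) fun k => by
      rw [hrecv, stepv, map_smul, map_sub, map_smul,
        L.starProjection_apply_eq_zero_iff.2 (hgL k), smul_zero, sub_zero]
  have hnormP : Tendsto (fun k => ‖Lᗮ.starProjection (v k)‖) atTop (𝓝 √(1 - ‖q‖ ^ 2)) := by
    refine ((hq.norm.pow 2).const_sub 1).sqrt.congr fun k => ?_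
    have h := L.norm_sq_eq_add_norm_sq_starProjection (v k)
    rw [hv1, one_pow] at h
    rw [h, add_sub_cancel_left, Real.sqrt_sq (norm_nonneg _)]
  have hvrep : ∀ k, (‖Lᗮ.starProjection (v k)‖ / ‖Lᗮ.starProjection (p (v k))‖) •
      Lᗮ.starProjection (p (v k)) + L.starProjection (v k) = v k := by
    intro k
    have h1 := hP0.trans_le (hPle _ (hV0 k))
    have h2 := ht0 k
    rw [hPp _ (hv1 k), norm_smul, Real.norm_of_nonneg h2.le, smul_smul]
    have : ‖Lᗮ.starProjection (v k)‖ / (t (v k) * ‖Lᗮ.starProjection (v k)‖) * t (v k) = 1 := by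
      field_simp
    rw [this, one_smul, add_comm, Submodule.starProjection_add_starProjection_orthogonal]
  obtain ⟨vs, hvs⟩ : ∃ vs, ∀ φ : ℕ → ℕ, StrictMono φ →
      Tendsto (fun i => p (v (φ i))) atTop (𝓝 us) → Tendsto (fun i => v (φ i)) atTop (𝓝 vs) := by
    refine ⟨(√(1 - ‖q‖ ^ 2) / ‖Lᗮ.starProjection us‖) • Lᗮ.starProjection us + q,
      fun φ hφ hlim => ?_⟩
    have hPw := (Lᗮ.starProjection.continuous.tendsto us).comp hlim
    refine ((((hnormP.comp hφ.tendsto_atTop).div hPw.norm hPus.ne').smul hPw).add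
      (hq.comp hφ.tendsto_atTop)).congr fun i => hvrep (φ i)
  have hvφ := hvs _ (hφ₀.comp hψ₀) hus
  have hvsV : vs ∈ V0 L v0L :=
    (isClosed_V0 hv0L).mem_of_tendsto hvφ (Eventually.of_forall fun i => hV0 _)
  have hpvs : p vs = us := tendsto_nhds_unique ((hpc vs hvsV).tendsto.comp
    (tendsto_nhdsWithin_iff.2 ⟨hvφ, Eventually.of_forall fun i => hV0 _⟩)) hus
  obtain ⟨R, hR, hRiso⟩ := Metric.eventually_nhds_iff.1 hiso
  obtain ⟨r₀, hr₀, hpr⟩ := Metric.continuousWithinAt_iff.1 (hpc vs hvsV) (R / 2) (by positivity)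
  have hs0 : Tendsto (fun k => 2 * (α k * ‖g k‖)) atTop (𝓝 0) := by
    have h : Tendsto (fun k => 2 * √(lmax * (α k * ‖g k‖ ^ 2))) atTop (𝓝 0) := by
      simpa using ((hsum.tendsto_atTop_zero.const_mul lmax).sqrt).const_mul 2
    refine squeeze_zero (fun k => by have := hα0 k; positivity) (fun k => ?_) h
    have hk := hα0 k
    refine mul_le_mul_of_nonneg_left (Real.le_sqrt_of_sq_le ?_) zero_le_two
    have : 0 ≤ α k * ‖g k‖ ^ 2 := by positivity
    nlinarith [mul_le_mul_of_nonneg_right (hαmax k) this]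
  have hd0 : Tendsto (fun k => ‖v k - vs‖) atTop (𝓝 0) := by
    refine tendsto_zero_of_annulus_summable (s := fun k => 2 * (α k * ‖g k‖))
      (a := fun k => α k * ‖g k‖ ^ 2) (fun k => norm_nonneg _)
      (fun k => by have := hα0 k; positivity) hsum hs0 (fun k => ?_) hr₀ ?_ ?_
    · have h1 := norm_sub_le_norm_sub_add_norm_sub (v (k + 1)) (v k) vs
      linarith [hstep k]
    · intro r hr hrr
      obtain ⟨ε, hε, hεk⟩ : ∃ ε > 0, ∀ᶠ k in atTop,
          r / 2 ≤ ‖v k - vs‖ → ‖v k - vs‖ ≤ r → ε ≤ ‖g k‖ := by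
        by_contra! hcon
        obtain ⟨φ, hφ, hPφ⟩ := extraction_forall_of_frequently
          (P := fun n k => r / 2 ≤ ‖v k - vs‖ ∧ ‖v k - vs‖ ≤ r ∧ ‖g k‖ < 1 / ((n : ℝ) + 1))
          fun n => by simpa using hcon (1 / ((n : ℝ) + 1)) (by positivity)
        obtain ⟨u, ψ, hψ, hu, hucrit⟩ := hcluster φ (hsmall φ fun n => (hPφ n).2.2)
        have hdist : dist u us ≤ R / 2 := by
          refine le_of_tendsto (hu.dist tendsto_const_nhds) (Eventually.of_forall fun i => ?_)
          rw [← hpvs]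
          refine (hpr (hV0 _) ?_).le
          rw [dist_eq_norm]
          exact (hPφ (ψ i)).2.1.trans_lt hrr
        rw [hRiso (hdist.trans_lt (by linarith)) hucrit] at hu
        have hv := hvs _ (hφ.comp hψ) hu
        have h0 : Tendsto (fun i => ‖v (φ (ψ i)) - vs‖) atTop (𝓝 0) := by
          simpa using (hv.sub_const vs).norm
        have := ge_of_tendsto h0 (Eventually.of_forall fun i => (hPφ (ψ i)).1)
        linarith
      refine ⟨2 / ε, ?_⟩
      filter_upwards [hεk] with k hk h1 h2
      rw [div_mul_eq_mul_div, le_div_iff₀ hε]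
      have : 0 ≤ 2 * (α k * ‖g k‖) := by have := hα0 k; positivity
      nlinarith [mul_le_mul_of_nonneg_left (hk h1 h2) this]
    · intro r hr
      have h0 : Tendsto (fun i => ‖v ((φ₀ ∘ ψ₀) i) - vs‖) atTop (𝓝 0) := by
        simpa using (hvφ.sub_const vs).norm
      exact (hφ₀.comp hψ₀).tendsto_atTop.frequently (h0.eventually_lt_const hr).frequently
  rw [← hpvs]
  exact (hpc vs hvsV).tendsto.comp (tendsto_nhdsWithin_iff.2
    ⟨tendsto_iff_norm_sub_tendsto_zero.2 hd0, Eventually.of_forall hV0⟩)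
end
end

section
/- Let M be a positive integer, let (E_k)_{k≥0} be a sequence of real numbers and (d_k)_{k≥0} a sequence of nonnegative reals satisfying E_{k+1} ≤ max_{1≤j≤min{M,k+1}} E_{k+1−j} − d_k for all k ≥ 0 (in the normalized GLL-type nonmonotone LMM, E_k = E(p(v_k)) and d_k = σ α_k t_k ‖g_k‖² ≥ 0). Set μ_0 = 0 and, for j ≥ 1, choose μ_j ∈ {(j−1)M+1, …, jM} such that E_{μ_j} = max{E_{(j−1)M+1}, …, E_{jM}}. Then E_{μ_{j+1}} ≤ E_{μ_j} − d_{μ_{j+1}−1} for all j ≥ 0; in particular, the subsequence (E_{μ_j})_{j≥0} is monotonically decreasing. -/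
open Filter Topology Set

/-- If a sequence satisfies the nonmonotone decrease condition with memory `M` and the `M` values
up to index `N` are bounded by `c`, then each of the next values lies below `c` by at least the
corresponding decrement. -/
theorem le_sub_of_nonmonotone_decrease {M : ℕ} {E d : ℕ → ℝ} (hd : ∀ k, 0 ≤ d k)
    (h : ∀ k : ℕ, ∃ i < min M (k + 1), E (k + 1) ≤ E (k - i) - d k)
    {N : ℕ} {c : ℝ} (hc : ∀ n ≤ N, N < n + M → E n ≤ c) (k : ℕ) (hk : N ≤ k) :
    E (k + 1) ≤ c - d k := by
  induction k using Nat.strong_induction_on with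
  | _ k ih =>
    obtain ⟨i, hi, hE⟩ := h k
    refine hE.trans (sub_le_sub_right ?_ _)
    by_cases hle : k - i ≤ N
    · exact hc _ hle (by omega)
    · obtain ⟨m, hm⟩ : ∃ m, k - i = m + 1 := ⟨k - i - 1, by omega⟩
      rw [hm]
      exact (ih m (by omega) (by omega)).trans (sub_le_self _ (hd m))

/-- Lemma 3.10: if `E_{k+1} ≤ max_{1≤j≤min{M,k+1}} E_{k+1−j} − d_k`
with `d_k ≥ 0`, and `μ_j` picks out the index of the maximum of the `j`-th block
`{(j−1)M+1, …, jM}` (with `μ_0 = 0`), then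
`E_{μ_{j+1}} ≤ E_{μ_j} − d_{μ_{j+1}−1}` for all `j`; in particular `(E_{μ_j})` is
monotonically decreasing.  (The maximum over `j = 1, …, min{M,k+1}` of `E_{k+1−j}` is
written as the maximum over `i = 0, …, min{M,k+1} − 1` of `E_{k−i}`.) -/
theorem statement18
    (M : ℕ) (hM : 1 ≤ M)
    (E d : ℕ → ℝ) (hd : ∀ k, 0 ≤ d k)
    (h : ∀ k : ℕ, E (k + 1) ≤
      (Finset.range (min M (k + 1))).sup'
          (Finset.nonempty_range_iff.mpr (by omega)) (fun i => E (k - i)) - d k)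
    (μ : ℕ → ℕ) (hμ0 : μ 0 = 0)
    (hμmem : ∀ j : ℕ, 1 ≤ j → (j - 1) * M + 1 ≤ μ j ∧ μ j ≤ j * M)
    (hμmax : ∀ j : ℕ, 1 ≤ j → ∀ i : ℕ, (j - 1) * M + 1 ≤ i → i ≤ j * M → E i ≤ E (μ j)) :
    (∀ j : ℕ, E (μ (j + 1)) ≤ E (μ j) - d (μ (j + 1) - 1)) ∧
    Antitone (fun j => E (μ j)) := by
  have hex : ∀ k : ℕ, ∃ i < min M (k + 1), E (k + 1) ≤ E (k - i) - d k := by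
    intro k
    obtain ⟨i, hi, hsup⟩ := Finset.exists_mem_eq_sup' (s := Finset.range (min M (k + 1)))
      (Finset.nonempty_range_iff.mpr (by omega)) (fun i => E (k - i))
    exact ⟨i, Finset.mem_range.mp hi, hsup ▸ h k⟩
  have step : ∀ j : ℕ, E (μ (j + 1)) ≤ E (μ j) - d (μ (j + 1) - 1) := by
    intro j
    have hlow : j * M + 1 ≤ μ (j + 1) := (hμmem (j + 1) (by omega)).1
    have hblock : ∀ n ≤ j * M, j * M < n + M → E n ≤ E (μ j) := by
      intro n hn hnM
      rcases j with _ | j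
      · obtain rfl : n = 0 := by omega
        rw [hμ0]
      · refine hμmax (j + 1) (by omega) n ?_ hn
        rw [Nat.add_mul] at hnM
        rw [Nat.add_sub_cancel]
        omega
    have key := le_sub_of_nonmonotone_decrease hd hex hblock (μ (j + 1) - 1) (by omega)
    rwa [Nat.sub_add_cancel (by omega)] at key
  exact ⟨step, antitone_nat_of_succ_le fun j => (step j).trans (sub_le_self _ (hd _))⟩
end
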